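/- Let K be a field and G a simple graph on [n]. The binomial edge ideal J_G ⊆ K[x_1,...,x_n,y_1,...,y_n] is a radical ideal. -/

import Mathlib

open MvPolynomial

/-- The binomial `f_{ij} = x_i y_j - x_j y_i` in `K[x_1,…,x_n,y_1,…,y_n]`. -/
noncomputable def edgeBinomial (K : Type*) [Field K] {n : ℕ} (i j : Fin n) :
    MvPolynomial (Fin n ⊕ Fin n) K :=
  X (Sum.inl i) * X (Sum.inr j) - X (Sum.inl j) * X (Sum.inr i)

/-- The binomial edge ideal `J_G` of a simple graph `G` on `[n]`. -/
noncomputable def binomialEdgeIdeal (K : Type*) [Field K] {n : ℕ}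
    (G : SimpleGraph (Fin n)) : Ideal (MvPolynomial (Fin n ⊕ Fin n) K) :=
  Ideal.span {p | ∃ i j : Fin n, G.Adj i j ∧ i < j ∧ p = edgeBinomial K i j}

namespace BEI

lemma edge_mem (K : Type*) [Field K] {n : ℕ} {G : SimpleGraph (Fin n)} {i j : Fin n}
    (h : G.Adj i j) : edgeBinomial K i j ∈ binomialEdgeIdeal K G := by
  rcases lt_trichotomy i j with hij | hij | hij
  · exact Ideal.subset_span ⟨i, j, h, hij, rfl⟩
  · exact absurd hij h.ne
  · have : edgeBinomial K i j = - edgeBinomial K j i := by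
      unfold edgeBinomial; ring
    rw [this]
    exact neg_mem (Ideal.subset_span ⟨j, i, h.symm, hij, rfl⟩)

lemma ideal_le (K : Type*) [Field K] {n : ℕ} {G : SimpleGraph (Fin n)}
    {I : Ideal (MvPolynomial (Fin n ⊕ Fin n) K)}
    (h : ∀ i j, G.Adj i j → edgeBinomial K i j ∈ I) : binomialEdgeIdeal K G ≤ I := by
  refine Ideal.span_le.2 ?_
  rintro p ⟨i, j, hij, -, rfl⟩
  exact h i j hij

/-- exponent vectors of the parametrization -/
noncomputable def ex {n : ℕ} (c : Fin n → Fin n) : Fin n ⊕ Fin n → (Fin n ⊕ Fin n →₀ ℕ)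
  | Sum.inl i => Finsupp.single (Sum.inl i) 1 + Finsupp.single (Sum.inr (c i)) 1
  | Sum.inr i => Finsupp.single (Sum.inl i) 1

/-- exponent map -/
noncomputable def E {n : ℕ} (c : Fin n → Fin n) (m : Fin n ⊕ Fin n →₀ ℕ) :
    Fin n ⊕ Fin n →₀ ℕ := ∑ s, m s • ex c s

lemma E_inl {n : ℕ} (c : Fin n → Fin n) (m : Fin n ⊕ Fin n →₀ ℕ) (i : Fin n) :
    E c m (Sum.inl i) = m (Sum.inl i) + m (Sum.inr i) := by
  simp [E, ex, Fintype.sum_sum_type, Finsupp.single_apply]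

lemma E_inr {n : ℕ} (c : Fin n → Fin n) (m : Fin n ⊕ Fin n →₀ ℕ) (i : Fin n) :
    E c m (Sum.inr i) = ∑ j with c j = i, m (Sum.inl j) := by
  simp [E, ex, Fintype.sum_sum_type, Finsupp.single_apply, Finset.sum_filter]

lemma E_add {n : ℕ} (c : Fin n → Fin n) (m m' : Fin n ⊕ Fin n →₀ ℕ) :
    E c (m + m') = E c m + E c m' := by
  simp [E, add_smul, Finset.sum_add_distrib]

lemma E_single {n : ℕ} (c : Fin n → Fin n) (s : Fin n ⊕ Fin n) :
    E c (Finsupp.single s 1) = ex c s := by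
  simp only [E, Finsupp.single_apply, ite_smul, one_smul, zero_smul]
  simp

/-- the parametrization -/
noncomputable def phi (K : Type*) [Field K] {n : ℕ} (c : Fin n → Fin n) :
    MvPolynomial (Fin n ⊕ Fin n) K →ₐ[K] MvPolynomial (Fin n ⊕ Fin n) K :=
  aeval fun s => monomial (ex c s) (1 : K)

lemma phi_monomial (K : Type*) [Field K] {n : ℕ} (c : Fin n → Fin n)
    (m : Fin n ⊕ Fin n →₀ ℕ) : phi K c (monomial m 1) = monomial (E c m) 1 := by
  rw [phi, aeval_monomial, map_one, one_mul, Finsupp.prod_fintype _ _ (by simp)]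
  simp only [monomial_pow, one_pow, E]
  rw [monomial_sum_one]

lemma swap_mem (K : Type*) [Field K] {n : ℕ} (G : SimpleGraph (Fin n)) {i j : Fin n}
    (h : G.Adj i j) (k : Fin n ⊕ Fin n →₀ ℕ) :
    monomial (k + (Finsupp.single (Sum.inl i) 1 + Finsupp.single (Sum.inr j) 1)) (1 : K) -
      monomial (k + (Finsupp.single (Sum.inl j) 1 + Finsupp.single (Sum.inr i) 1)) (1 : K)
      ∈ binomialEdgeIdeal K G := by
  have : monomial (k + (Finsupp.single (Sum.inl i) 1 + Finsupp.single (Sum.inr j) 1)) (1 : K) -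
      monomial (k + (Finsupp.single (Sum.inl j) 1 + Finsupp.single (Sum.inr i) 1)) (1 : K)
      = monomial k 1 * edgeBinomial K i j := by
    simp only [edgeBinomial, X, mul_sub, monomial_mul, mul_one]
  rw [this]
  exact Ideal.mul_mem_left _ _ (edge_mem K h)

lemma connect (K : Type*) [Field K] {n : ℕ} (G : SimpleGraph (Fin n)) (c : Fin n → Fin n)
    (hc : ∀ i j, c i = c j → i ≠ j → G.Adj i j) (m' : Fin n ⊕ Fin n →₀ ℕ) (D : ℕ) :
    ∀ m : Fin n ⊕ Fin n →₀ ℕ, ∑ i, (m (Sum.inl i) - m' (Sum.inl i)) = D → E c m = E c m' →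
      monomial m (1 : K) - monomial m' 1 ∈ binomialEdgeIdeal K G := by
  induction D using Nat.strong_induction_on with
  | _ D ih =>
  intro m hD hE
  have h1 : ∀ i, m (Sum.inl i) + m (Sum.inr i) = m' (Sum.inl i) + m' (Sum.inr i) := by
    intro i; rw [← E_inl c, ← E_inl c, hE]
  have h2 : ∀ i, ∑ j with c j = i, m (Sum.inl j) = ∑ j with c j = i, m' (Sum.inl j) := by
    intro i; rw [← E_inr c, ← E_inr c, hE]
  by_cases hle : ∀ i, m (Sum.inl i) ≤ m' (Sum.inl i)
  · have heq : ∀ i, m (Sum.inl i) = m' (Sum.inl i) := by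
      intro i
      exact (Finset.sum_eq_sum_iff_of_le (fun j _ => hle j)).1 (h2 (c i)) i (by simp)
    have : m = m' := by
      ext s
      rcases s with i | i
      · exact heq i
      · have := h1 i; have := heq i; omega
    rw [this, sub_self]; exact zero_mem _
  · push Not at hle
    obtain ⟨i, hi⟩ := hle
    obtain ⟨j, hj, hjlt⟩ : ∃ j, c j = c i ∧ m (Sum.inl j) < m' (Sum.inl j) := by
      by_contra! hcon
      have := Finset.sum_lt_sum (s := Finset.univ.filter fun j => c j = c i)
        (f := fun j => m' (Sum.inl j)) (g := fun j => m (Sum.inl j))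
        (fun j hj => hcon j (by simpa using hj)) ⟨i, by simp, hi⟩
      exact absurd (h2 (c i)) this.ne'
    have hij : i ≠ j := by rintro rfl; omega
    have hadj : G.Adj i j := hc i j hj.symm hij
    have h1j := h1 j
    obtain ⟨k, rfl⟩ : ∃ k, m = k + (Finsupp.single (Sum.inl i) 1 + Finsupp.single (Sum.inr j) 1) := by
      refine ⟨m - (Finsupp.single (Sum.inl i) 1 + Finsupp.single (Sum.inr j) 1), ?_⟩
      rw [tsub_add_cancel_of_le]
      intro s
      rcases s with s | s <;> simp only [Finsupp.add_apply, Finsupp.single_apply, Sum.inl.injEq,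
        Sum.inr.injEq, reduceCtorEq, if_false] <;> split_ifs with hs <;> (try subst hs) <;> omega
    have hsw := swap_mem K G hadj k
    rw [← sub_add_sub_cancel]
    refine add_mem hsw (ih _ ?_ _ rfl ?_)
    · rw [← hD]
      refine Finset.sum_lt_sum ?_ ⟨i, Finset.mem_univ _, ?_⟩
      · intro s _
        have hjs : s = j → k (Sum.inl s) < m' (Sum.inl s) := by
          rintro rfl
          simpa [Finsupp.single_apply, hij] using hjlt
        simp only [Finsupp.add_apply, Finsupp.single_apply, Sum.inl.injEq, reduceCtorEq, if_false]
        by_cases hs : s = j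
        · have := hjs hs
          split_ifs <;> omega
        · rw [if_neg (Ne.symm hs)]
          split_ifs <;> omega
      · simp [Finsupp.single_apply, hij, hij.symm] at hi ⊢
        omega
    · rw [← hE]
      simp only [E_add, E_single, ex, hj]
      abel

lemma base (K : Type*) [Field K] {n : ℕ} (G : SimpleGraph (Fin n)) (c : Fin n → Fin n)
    (hc : ∀ i j, c i = c j → i ≠ j → G.Adj i j) (hc' : ∀ i j, G.Adj i j → c i = c j) :
    (binomialEdgeIdeal K G).IsRadical := by
  have hker : binomialEdgeIdeal K G = RingHom.ker (phi K c) := by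
    apply le_antisymm
    · apply ideal_le
      intro i j hij
      rw [RingHom.mem_ker, edgeBinomial, map_sub]
      simp only [X, monomial_mul, mul_one, phi_monomial, E_add, E_single, ex, hc' i j hij]
      rw [sub_eq_zero]
      congr 1
      congr 1
      abel
    · intro f hf
      let R : MvPolynomial (Fin n ⊕ Fin n) K →ₗ[K] MvPolynomial (Fin n ⊕ Fin n) K :=
        (basisMonomials (Fin n ⊕ Fin n) K).constr K
          (fun μ => monomial (Function.invFun (E c) μ) (1 : K))
      have hR : ∀ μ, R (monomial μ 1) = monomial (Function.invFun (E c) μ) (1 : K) := by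
        intro μ
        have := (basisMonomials (Fin n ⊕ Fin n) K).constr_basis K
          (fun μ => monomial (Function.invFun (E c) μ) (1 : K)) μ
        rwa [coe_basisMonomials] at this
      have key : ∀ f, f - R (phi K c f) ∈ binomialEdgeIdeal K G := by
        intro f
        induction f using MvPolynomial.induction_on' with
        | monomial m a =>
          have : monomial m a = a • monomial m (1 : K) := by simp [smul_monomial]
          rw [this, map_smul, map_smul, ← smul_sub, phi_monomial, hR, smul_eq_C_mul]
          refine Ideal.mul_mem_left _ _ (connect K G c hc _ _ _ rfl ?_)
          exact (Function.invFun_eq (f := E c) ⟨m, rfl⟩).symm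
        | add p q hp hq =>
          rw [map_add, map_add, add_sub_add_comm]
          exact add_mem hp hq
      have := key f
      rwa [(RingHom.mem_ker).1 hf, map_zero, sub_zero] at this
  rw [hker]
  exact (RingHom.ker_isPrime (phi K c)).isRadical

/-- delete all edges at `v` -/
def del {n : ℕ} (G : SimpleGraph (Fin n)) (v : Fin n) : SimpleGraph (Fin n) where
  Adj i j := G.Adj i j ∧ i ≠ v ∧ j ≠ v
  symm := ⟨fun _ _ h => ⟨h.1.symm, h.2.2, h.2.1⟩⟩
  loopless := ⟨fun _ h => h.1.ne rfl⟩

/-- complete the neighbourhood of `v` -/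
def comp {n : ℕ} (G : SimpleGraph (Fin n)) (v : Fin n) : SimpleGraph (Fin n) where
  Adj i j := G.Adj i j ∨ (G.Adj v i ∧ G.Adj v j ∧ i ≠ j)
  symm := ⟨fun _ _ h => h.elim (fun h => Or.inl h.symm) fun h => Or.inr ⟨h.2.1, h.1, h.2.2.symm⟩⟩
  loopless := ⟨fun _ h => h.elim (fun h => h.ne rfl) fun h => h.2.2 rfl⟩

/-- kill the variables at `v` -/
noncomputable def rho (K : Type*) [Field K] {n : ℕ} (v : Fin n) :
    MvPolynomial (Fin n ⊕ Fin n) K →ₐ[K] MvPolynomial (Fin n ⊕ Fin n) K :=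
  aeval (Sum.elim (fun i => if i = v then 0 else X (Sum.inl i))
    (fun i => if i = v then 0 else X (Sum.inr i)))

lemma rho_sub (K : Type*) [Field K] {n : ℕ} (v : Fin n) (a : MvPolynomial (Fin n ⊕ Fin n) K) :
    a - rho K v a ∈ Ideal.span {X (Sum.inl v), X (Sum.inr v)} := by
  induction a using MvPolynomial.induction_on with
  | C a => simp [rho]
  | add p q hp hq => rw [map_add, add_sub_add_comm]; exact add_mem hp hq
  | mul_X p s hp =>
    have hX : X s - rho K v (X s) ∈
        Ideal.span {(X (Sum.inl v) : MvPolynomial (Fin n ⊕ Fin n) K), X (Sum.inr v)} := by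
      rcases s with i | i
      · by_cases h : i = v
        · subst h; simp only [rho, aeval_X, Sum.elim_inl, if_true, sub_zero]
          exact Ideal.subset_span (by simp)
        · simp [rho, h]
      · by_cases h : i = v
        · subst h; simp only [rho, aeval_X, Sum.elim_inr, if_true, sub_zero]
          exact Ideal.subset_span (by simp)
        · simp [rho, h]
    have : p * X s - rho K v (p * X s) =
        X s * (p - rho K v p) + rho K v p * (X s - rho K v (X s)) := by
      rw [map_mul]; ring
    rw [this]
    exact add_mem (Ideal.mul_mem_left _ _ hp) (Ideal.mul_mem_left _ _ hX)

lemma rho_edge_ne (K : Type*) [Field K] {n : ℕ} {v i j : Fin n} (hi : i ≠ v) (hj : j ≠ v) :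
    rho K v (edgeBinomial K i j) = edgeBinomial K i j := by
  simp [rho, edgeBinomial, hi, hj]

lemma rho_edge_eq (K : Type*) [Field K] {n : ℕ} {v i j : Fin n} (h : i = v ∨ j = v) :
    rho K v (edgeBinomial K i j) = 0 := by
  rcases h with rfl | rfl <;> simp [rho, edgeBinomial]

lemma mul_edge_mem (K : Type*) [Field K] {n : ℕ} (G : SimpleGraph (Fin n)) {v i j : Fin n}
    (h : (comp G v).Adj i j) {a : MvPolynomial (Fin n ⊕ Fin n) K}
    (ha : a ∈ Ideal.span {X (Sum.inl v), X (Sum.inr v)}) :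
    a * edgeBinomial K i j ∈ binomialEdgeIdeal K G := by
  rcases h with h | ⟨hi, hj, -⟩
  · exact Ideal.mul_mem_left _ _ (edge_mem K h)
  · obtain ⟨p, q, rfl⟩ := Ideal.mem_span_pair.1 ha
    have : (p * X (Sum.inl v) + q * X (Sum.inr v)) * edgeBinomial K i j =
        (p * X (Sum.inl i) + q * X (Sum.inr i)) * edgeBinomial K v j
        - (p * X (Sum.inl j) + q * X (Sum.inr j)) * edgeBinomial K v i := by
      unfold edgeBinomial; ring
    rw [this]
    exact sub_mem (Ideal.mul_mem_left _ _ (edge_mem K hj)) (Ideal.mul_mem_left _ _ (edge_mem K hi))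

lemma sub_rho_mem (K : Type*) [Field K] {n : ℕ} (G : SimpleGraph (Fin n)) (v : Fin n)
    {h : MvPolynomial (Fin n ⊕ Fin n) K} (hh : h ∈ binomialEdgeIdeal K (comp G v)) :
    h - rho K v h ∈ binomialEdgeIdeal K G := by
  unfold binomialEdgeIdeal at hh
  induction hh using Submodule.span_induction with
  | mem x hx =>
    obtain ⟨i, j, hij, -, rfl⟩ := hx
    by_cases hv : i = v ∨ j = v
    · rw [rho_edge_eq K hv, sub_zero]
      refine edge_mem K ?_
      rcases hij with hij | ⟨h1, h2, -⟩
      · exact hij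
      · rcases hv with rfl | rfl
        · exact h2
        · exact h1.symm
    · push Not at hv
      rw [rho_edge_ne K hv.1 hv.2, sub_self]; exact zero_mem _
  | zero => simp
  | add x y _ _ hx hy => rw [map_add, add_sub_add_comm]; exact add_mem hx hy
  | smul a x hx' hx =>
    have hmul : ∀ b ∈ Ideal.span {(X (Sum.inl v) : MvPolynomial (Fin n ⊕ Fin n) K), X (Sum.inr v)},
        b * x ∈ binomialEdgeIdeal K G := by
      intro b hb
      clear hx
      induction hx' using Submodule.span_induction with
      | mem x hx =>
        obtain ⟨i, j, hij, -, rfl⟩ := hx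
        exact mul_edge_mem K G hij hb
      | zero => simp
      | add x y _ _ hx hy => rw [mul_add]; exact add_mem hx hy
      | smul c x _ hx => rw [smul_eq_mul, mul_left_comm]; exact Ideal.mul_mem_left _ _ hx
    have : a • x - rho K v (a • x) = (a - rho K v a) * x + rho K v a * (x - rho K v x) := by
      rw [smul_eq_mul, map_mul]; ring
    rw [this]
    exact add_mem (hmul _ (rho_sub K v a)) (Ideal.mul_mem_left _ _ hx)

lemma step (K : Type*) [Field K] {n : ℕ} (G : SimpleGraph (Fin n)) (v : Fin n)
    (h1 : (binomialEdgeIdeal K (comp G v)).IsRadical)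
    (h2 : (binomialEdgeIdeal K (del G v)).IsRadical) : (binomialEdgeIdeal K G).IsRadical := by
  rintro h ⟨k, hk⟩
  have a1 : h ∈ binomialEdgeIdeal K (comp G v) :=
    h1 ⟨k, ideal_le K (fun i j hij => edge_mem K (Or.inl hij)) hk⟩
  have hle : binomialEdgeIdeal K G ≤ (binomialEdgeIdeal K (del G v)).comap (rho K v) := by
    apply ideal_le
    intro i j hij
    rw [Ideal.mem_comap]
    by_cases hv : i = v ∨ j = v
    · rw [rho_edge_eq K hv]; exact zero_mem _
    · push Not at hv
      rw [rho_edge_ne K hv.1 hv.2]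
      exact edge_mem K ⟨hij, hv⟩
  have a2 : rho K v h ∈ binomialEdgeIdeal K (del G v) := by
    refine h2 ⟨k, ?_⟩
    rw [← map_pow]
    exact hle hk
  have a3 : rho K v h ∈ binomialEdgeIdeal K G :=
    ideal_le K (G := del G v) (fun i j hij => edge_mem K hij.1) a2
  have := add_mem (sub_rho_mem K G v a1) a3
  rwa [sub_add_cancel] at this

theorem main (K : Type*) [Field K] {n : ℕ} (a b : ℕ) :
    ∀ G : SimpleGraph (Fin n), {i | ∃ j, G.Adj i j}.ncard = a →
      {p : Fin n × Fin n | ¬ G.Adj p.1 p.2}.ncard = b → (binomialEdgeIdeal K G).IsRadical := by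
  induction a using Nat.strong_induction_on generalizing b with
  | _ a iha =>
  induction b using Nat.strong_induction_on with
  | _ b ihb =>
  intro G ha hb
  by_cases ht : ∀ v i j, G.Adj v i → G.Adj v j → i ≠ j → G.Adj i j
  · let s : Setoid (Fin n) :=
      { r := fun i j => i = j ∨ G.Adj i j
        iseqv := by
          refine ⟨fun _ => Or.inl rfl, fun h => h.elim (fun h => Or.inl h.symm)
            fun h => Or.inr h.symm, ?_⟩
          rintro x y z (rfl | h) (rfl | h')
          · exact Or.inl rfl
          · exact Or.inr h'
          · exact Or.inr h
          · by_cases hxz : x = z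
            · exact Or.inl hxz
            · exact Or.inr (ht y x z h.symm h' hxz) }
    refine base K G (fun i => (Quotient.mk s i).out) ?_ ?_
    · intro i j hij hne
      have := Quotient.out_injective hij
      exact (Quotient.exact this).resolve_left hne
    · intro i j hij
      exact congrArg Quotient.out (Quotient.sound (s := s) (Or.inr hij))
  · push Not at ht
    obtain ⟨v, i, j, hi, hj, hne, hnadj⟩ := ht
    refine step K G v ?_ ?_
    · refine ihb _ ?_ (comp G v) ?_ rfl
      · rw [← hb]
        apply Set.ncard_lt_ncard _ (Set.toFinite _)
        refine ⟨fun p hp h => hp (Or.inl h), fun h => ?_⟩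
        exact h (a := (i, j)) hnadj (Or.inr ⟨hi, hj, hne⟩)
      · rw [← ha]
        congr 1
        ext x
        constructor
        · rintro ⟨y, hy | hy⟩
          · exact ⟨y, hy⟩
          · exact ⟨v, hy.1.symm⟩
        · rintro ⟨y, hy⟩
          exact ⟨y, Or.inl hy⟩
    · refine iha _ ?_ _ (del G v) rfl rfl
      rw [← ha]
      apply Set.ncard_lt_ncard _ (Set.toFinite _)
      refine ⟨fun x ⟨y, hy⟩ => ⟨y, hy.1⟩, fun h => ?_⟩
      obtain ⟨y, hy⟩ := h (a := v) ⟨i, hi⟩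
      exact hy.2.1 rfl

end BEI

/-- The binomial edge ideal `J_G` is a radical ideal. -/
theorem binomialEdgeIdeal_isRadical (K : Type*) [Field K] {n : ℕ}
    (G : SimpleGraph (Fin n)) : (binomialEdgeIdeal K G).IsRadical :=
  BEI.main K _ _ G rfl rfl
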